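/- With all definitions as in the context, for every r ∈ (0,R] the functions u, P_rr, P_θθ satisfy the three axisymmetric equilibrium equations of the relaxed micromorphic extension problem: (i) (2μ_e + λ_e)·d/dr(u'(r) − P_rr(r)) + λ_e·d/dr(u(r)/r − P_θθ(r)) = −2μ_e·d/dr(u(r)/r − P_θθ(r)) − 2μ_e·(P_θθ'(r) + (P_θθ(r) − P_rr(r))/r); (ii) (2μ_e + λ_e)·(u'(r) − P_rr(r)) + λ_e·(u(r)/r − P_θθ(r)) = 2μ_m·P_rr(r) + λ_m·(P_rr(r) + P_θθ(r)) − (μ_M·L_c²/r)·(P_θθ'(r) + (P_θθ(r) − P_rr(r))/r); (iii) (2μ_e + λ_e)·(u(r)/r − P_θθ(r)) + λ_e·(u'(r) − P_rr(r)) = 2μ_m·P_θθ(r) + λ_m·(P_rr(r) + P_θθ(r)) − μ_M·L_c²·d/dr(P_θθ'(r) + (P_θθ(r) − P_rr(r))/r). Moreover the boundary conditions u(R) = U₀ and P_θθ(R) = U₀/R hold. -/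

import Mathlib

open Real Filter Set

/-- Modified Bessel function of the first kind of order zero:
`I₀(x) = ∑ x^(2n) / (4^n (n!)²)`. -/
noncomputable def I0 (x : ℝ) : ℝ :=
  ∑' n : ℕ, x ^ (2 * n) / ((4 : ℝ) ^ n * ((n.factorial : ℝ)) ^ 2)

/-- Modified Bessel function of the first kind of order one:
`I₁(x) = ∑ x^(2n+1) / (2^(2n+1) n! (n+1)!)`. -/
noncomputable def I1 (x : ℝ) : ℝ :=
  ∑' n : ℕ, x ^ (2 * n + 1) /
    ((2 : ℝ) ^ (2 * n + 1) * (n.factorial : ℝ) * (((n + 1).factorial : ℝ)))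

theorem summable_I0_terms (x : ℝ) :
    Summable fun n : ℕ => x ^ (2 * n) / ((4 : ℝ) ^ n * ((n.factorial : ℝ)) ^ 2) := by
  refine Summable.of_nonneg_of_le (fun n => ?_) (fun n => ?_)
    (Real.summable_pow_div_factorial (x ^ 2))
  · rw [pow_mul]; positivity
  · rw [pow_mul]
    have hf : (1 : ℝ) ≤ n.factorial := by exact_mod_cast n.factorial_pos
    have h4 : (1 : ℝ) ≤ 4 ^ n := one_le_pow₀ (by norm_num)
    gcongr
    nlinarith [mul_le_mul h4 (le_refl ((n.factorial : ℝ) ^ 2)) (by positivity) (by positivity)]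

theorem summable_I1_terms (x : ℝ) :
    Summable fun n : ℕ => x ^ (2 * n + 1) /
      ((2 : ℝ) ^ (2 * n + 1) * (n.factorial : ℝ) * (((n + 1).factorial : ℝ))) := by
  refine Summable.of_norm_bounded ((Real.summable_pow_div_factorial (x ^ 2)).mul_left |x|)
    (fun n => ?_)
  have hf : (1 : ℝ) ≤ (n + 1).factorial := by exact_mod_cast (n + 1).factorial_pos
  have h2 : (1 : ℝ) ≤ 2 ^ (2 * n + 1) := one_le_pow₀ (by norm_num)
  have hx : |x| * ((x ^ 2) ^ n / n.factorial) = |x| ^ (2 * n + 1) / n.factorial := by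
    rw [pow_succ _ (2 * n), pow_mul, sq_abs]; ring
  rw [hx, norm_div, norm_pow, Real.norm_eq_abs, Real.norm_of_nonneg (by positivity)]
  gcongr
  have hn : (0 : ℝ) < n.factorial := by positivity
  calc (n.factorial : ℝ) = 1 * n.factorial * 1 := by ring
    _ ≤ _ := by gcongr

theorem hasDerivAt_I0 (x : ℝ) : HasDerivAt I0 (I1 x) x := by
  set M : ℝ := |x| + 1 with hM
  have hM1 : 1 ≤ M := by rw [hM]; linarith [abs_nonneg x]
  have hx : x ∈ Metric.ball (0 : ℝ) M := by simp [hM]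
  have key := hasDerivAt_tsum_of_isPreconnected
    (g := fun (n : ℕ) (y : ℝ) => y ^ (2 * n) / ((4 : ℝ) ^ n * ((n.factorial : ℝ)) ^ 2))
    (g' := fun (n : ℕ) (y : ℝ) =>
      ((2 * n : ℕ) * y ^ (2 * n - 1)) / ((4 : ℝ) ^ n * ((n.factorial : ℝ)) ^ 2))
    (u := fun n : ℕ => (M ^ 2) ^ n / n.factorial * 2)
    ((Real.summable_pow_div_factorial (M ^ 2)).mul_right 2) Metric.isOpen_ball
    (convex_ball (0 : ℝ) M).isPreconnected
    (fun n y _ => (hasDerivAt_pow (2 * n) y).div_const _) (fun n y hy => ?_) hx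
    (summable_I0_terms x) hx
  · have hshift : I1 x = ∑' n : ℕ,
        ((2 * n : ℕ) * x ^ (2 * n - 1)) / ((4 : ℝ) ^ n * ((n.factorial : ℝ)) ^ 2) := by
      have hterm : ∀ n : ℕ, (((2 * (n + 1) : ℕ) : ℝ) * x ^ (2 * (n + 1) - 1)) /
          ((4 : ℝ) ^ (n + 1) * (((n + 1).factorial : ℝ)) ^ 2) = x ^ (2 * n + 1) /
          ((2 : ℝ) ^ (2 * n + 1) * (n.factorial : ℝ) * (((n + 1).factorial : ℝ))) := by
        intro n
        have hn : (n.factorial : ℝ) ≠ 0 := by positivity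
        have h4 : (4 : ℝ) ^ n = 2 ^ (2 * n) := by rw [pow_mul]; norm_num
        rw [show 2 * (n + 1) - 1 = 2 * n + 1 by omega, Nat.factorial_succ, pow_succ (4 : ℝ), h4]
        push_cast
        field_simp
        ring
      have hs : Summable fun n : ℕ =>
          ((2 * n : ℕ) * x ^ (2 * n - 1)) / ((4 : ℝ) ^ n * ((n.factorial : ℝ)) ^ 2) := by
        rw [← summable_nat_add_iff 1]
        exact (summable_I1_terms x).congr (fun n => (hterm n).symm)
      rw [hs.tsum_eq_zero_add, tsum_congr hterm]
      simp [I1]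
    rw [hshift]
    exact key
  · have hy' : |y| ≤ M := by simpa using (mem_ball_zero_iff.mp hy).le
    have hf : (1 : ℝ) ≤ n.factorial := by exact_mod_cast n.factorial_pos
    have hn4 : ((2 * n : ℕ) : ℝ) ≤ 4 ^ n * 2 := by
      have : n < 4 ^ n := Nat.lt_pow_self (by norm_num)
      have : 2 * n ≤ 4 ^ n * 2 := by omega
      exact_mod_cast this
    have hp : |y| ^ (2 * n - 1) ≤ (M ^ 2) ^ n := by
      rw [← pow_mul]
      exact (pow_le_pow_left₀ (abs_nonneg y) hy' _).trans (pow_le_pow_right₀ hM1 (by omega))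
    rw [norm_div, norm_mul, norm_pow, Real.norm_eq_abs y, Real.norm_of_nonneg (by positivity),
      Real.norm_of_nonneg (by positivity)]
    calc ((2 * n : ℕ) : ℝ) * |y| ^ (2 * n - 1) / (4 ^ n * (n.factorial : ℝ) ^ 2)
        ≤ (4 ^ n * 2) * (M ^ 2) ^ n / (4 ^ n * (n.factorial : ℝ)) := by
          gcongr
          nlinarith
      _ = (M ^ 2) ^ n / n.factorial * 2 := by
          field_simp

theorem hasDerivAt_I1 {x : ℝ} (hx0 : x ≠ 0) : HasDerivAt I1 (I0 x - I1 x / x) x := by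
  set M : ℝ := |x| + 1 with hM
  have hx : x ∈ Metric.ball (0 : ℝ) M := by simp [hM]
  have key := hasDerivAt_tsum_of_isPreconnected
    (g := fun (n : ℕ) (y : ℝ) => y ^ (2 * n + 1) /
      ((2 : ℝ) ^ (2 * n + 1) * (n.factorial : ℝ) * (((n + 1).factorial : ℝ))))
    (g' := fun (n : ℕ) (y : ℝ) => ((2 * n + 1 : ℕ) * y ^ (2 * n + 1 - 1)) /
      ((2 : ℝ) ^ (2 * n + 1) * (n.factorial : ℝ) * (((n + 1).factorial : ℝ))))
    (u := fun n : ℕ => (M ^ 2) ^ n / n.factorial)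
    (Real.summable_pow_div_factorial (M ^ 2)) Metric.isOpen_ball
    (convex_ball (0 : ℝ) M).isPreconnected
    (fun n y _ => (hasDerivAt_pow (2 * n + 1) y).div_const _) (fun n y hy => ?_) hx
    (summable_I1_terms x) hx
  · have hsum : I0 x - I1 x / x = ∑' n : ℕ, ((2 * n + 1 : ℕ) * x ^ (2 * n + 1 - 1)) /
        ((2 : ℝ) ^ (2 * n + 1) * (n.factorial : ℝ) * (((n + 1).factorial : ℝ))) := by
      rw [I0, I1, ← tsum_div_const,
        ← (summable_I0_terms x).tsum_sub ((summable_I1_terms x).div_const x)]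
      refine tsum_congr fun n => ?_
      have hn : (n.factorial : ℝ) ≠ 0 := by positivity
      have h4 : (4 : ℝ) ^ n = 2 ^ (2 * n) := by rw [pow_mul]; norm_num
      rw [Nat.add_sub_cancel, Nat.factorial_succ, h4]
      push_cast
      field_simp
      ring
    rw [hsum]
    exact key
  · have hy' : |y| ≤ M := by simpa using (mem_ball_zero_iff.mp hy).le
    have hf : (1 : ℝ) ≤ (n + 1).factorial := by exact_mod_cast (n + 1).factorial_pos
    have hn2 : ((2 * n + 1 : ℕ) : ℝ) ≤ 2 ^ (2 * n + 1) := by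
      exact_mod_cast (Nat.lt_pow_self (by norm_num : 1 < 2)).le
    rw [Nat.add_sub_cancel, norm_div, norm_mul, norm_pow, Real.norm_eq_abs y,
      Real.norm_of_nonneg (by positivity), Real.norm_of_nonneg (by positivity), ← pow_mul]
    calc ((2 * n + 1 : ℕ) : ℝ) * |y| ^ (2 * n) /
          (2 ^ (2 * n + 1) * (n.factorial : ℝ) * ((n + 1).factorial : ℝ))
        ≤ 2 ^ (2 * n + 1) * M ^ (2 * n) / (2 ^ (2 * n + 1) * (n.factorial : ℝ) * 1) := by
          gcongr
      _ = M ^ (2 * n) / n.factorial := by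
          field_simp

theorem hasDerivAt_I0_mul (k r : ℝ) :
    HasDerivAt (fun t => I0 (k * t)) (k * I1 (k * r)) r := by
  have h := (hasDerivAt_I0 (k * r)).comp r ((hasDerivAt_id r).const_mul k)
  simpa [Function.comp_def, mul_comm] using h

theorem hasDerivAt_I1_mul {k r : ℝ} (hk : k ≠ 0) (hr : r ≠ 0) :
    HasDerivAt (fun t => I1 (k * t)) (k * I0 (k * r) - I1 (k * r) / r) r := by
  have h := (hasDerivAt_I1 (mul_ne_zero hk hr)).comp r ((hasDerivAt_id' r).const_mul k)
  refine h.congr_deriv ?_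
  field_simp

/-- the closed-form fields `u`, `P_rr`, `P_θθ` of the relaxed micromorphic
axisymmetric extension problem satisfy the three equilibrium equations on `(0,R]`,
together with the boundary conditions `u(R) = U₀` and `P_θθ(R) = U₀/R`. -/
theorem closed_form_solves_problem
    (lam_e μe lam_m μm Lc R U₀ : ℝ)
    (hμe : 0 < μe) (hμm : 0 < μm) (hLc : 0 < Lc) (hR : 0 < R)
    (κe κm : ℝ) (hκe : κe = lam_e + μe) (hκm : κm = lam_m + μm)
    (hκe0 : 0 < κe) (hκm0 : 0 < κm)
    (μM : ℝ) (hμM : μM = μe * μm / (μe + μm))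
    (a : ℝ) (ha : a = 4 / (μM * Lc ^ 2) * (μe * κe / (κe + μe) + μm * κm / (κm + μm)))
    (A : ℝ) (hA : A = 1 + (μm * lam_e - μe * lam_m) * κe /
        (μe * (κm + μm) * κe + μm * (κe + μe) * κm))
    (B : ℝ) (hB : B = (μm * lam_e - μe * lam_m) / (μm * (μe + κe)))
    (ξ₁ : ℝ) (hξ₁ : ξ₁ = -((κm + μm) / (2 * μm)))
    (ξ₂ : ℝ) (hξ₂ : ξ₂ = -(μe * (κm + μm) / (μm * (κe + μe))))
    (ξ₃ : ℝ) (hξ₃ : ξ₃ = κm * μm * (κe + μe) / (κe * μe * (κm + μm) + κm * μm * (κe + μe)))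
    (Δ : ℝ) (hΔ : Δ = A * (I1 (Real.sqrt a * R) * (2 * ξ₁ - ξ₂) -
        ξ₁ * Real.sqrt a * R * I0 (Real.sqrt a * R)) + B * ξ₃ * I1 (Real.sqrt a * R))
    (hΔ0 : Δ ≠ 0)
    (C₁ : ℝ) (hC₁ : C₁ = 2 * U₀ / R * (I1 (Real.sqrt a * R) * (2 * ξ₁ - ξ₂) -
        ξ₁ * Real.sqrt a * R * I0 (Real.sqrt a * R)) / Δ)
    (D₁ : ℝ) (hD₁ : D₁ = U₀ * ξ₃ * Real.sqrt a / Δ)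
    (b : ℝ) (hb : b = 4 / (μM * Lc ^ 2) * (C₁ * κe * μm / (κm + μm)))
    (Z u Pθθ Prr : ℝ → ℝ)
    (hZ : ∀ r : ℝ, Z r = b / a + D₁ * I0 (Real.sqrt a * r))
    (hu : ∀ r : ℝ, u r = C₁ * A * r / 2 + D₁ * B / Real.sqrt a * I1 (Real.sqrt a * r))
    (hPθθ : ∀ r : ℝ, Pθθ r = C₁ / 2 * (A - ξ₃) - D₁ * ξ₁ * I0 (Real.sqrt a * r) +
        D₁ * I1 (Real.sqrt a * r) / (Real.sqrt a * r) * (B + 2 * ξ₁ - ξ₂))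
    (hPrr : ∀ r : ℝ, Prr r = Z r - Pθθ r) :
    (∀ r ∈ Set.Ioc (0 : ℝ) R,
      ((2 * μe + lam_e) * deriv (fun s => deriv u s - Prr s) r +
          lam_e * deriv (fun s => u s / s - Pθθ s) r =
        -(2 * μe) * deriv (fun s => u s / s - Pθθ s) r -
          2 * μe * (deriv Pθθ r + (Pθθ r - Prr r) / r)) ∧
      ((2 * μe + lam_e) * (deriv u r - Prr r) + lam_e * (u r / r - Pθθ r) =
        2 * μm * Prr r + lam_m * (Prr r + Pθθ r) -
          μM * Lc ^ 2 / r * (deriv Pθθ r + (Pθθ r - Prr r) / r)) ∧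
      ((2 * μe + lam_e) * (u r / r - Pθθ r) + lam_e * (deriv u r - Prr r) =
        2 * μm * Pθθ r + lam_m * (Prr r + Pθθ r) -
          μM * Lc ^ 2 * deriv (fun s => deriv Pθθ s + (Pθθ s - Prr s) / s) r)) ∧
    u R = U₀ ∧ Pθθ R = U₀ / R := by
  have hμM0 : 0 < μM := by rw [hμM]; positivity
  have ha0 : 0 < a := by rw [ha]; positivity
  have hs0 : 0 < Real.sqrt a := Real.sqrt_pos.mpr ha0
  have hsa : Real.sqrt a ^ 2 = a := Real.sq_sqrt ha0.le
  have hle : lam_e = κe - μe := by linarith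
  have hlm : lam_m = κm - μm := by linarith
  have haL : μM * Lc ^ 2 * a =
      4 * (μe * κe / (κe + μe) + μm * κm / (κm + μm)) := by
    rw [ha]; field_simp
  have hBξ₂ : ξ₂ = B - 1 := by
    rw [hB, hξ₂, hle, hlm]; field_simp; ring
  have hBξ₁ : (κe + μe) * (B - 1) = 2 * μe * ξ₁ := by
    rw [← hBξ₂, hξ₂, hξ₁]; field_simp
  have hξ₁m : 2 * μm * ξ₁ = -(κm + μm) := by
    rw [hξ₁]; field_simp
  have hAξ₃ : A - ξ₃ = κe * μm * (κe + μe) /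
      (κe * μe * (κm + μm) + κm * μm * (κe + μe)) := by
    rw [hA, hξ₃, hle, hlm]; field_simp; ring
  have hba : b / a = C₁ * (A - ξ₃) := by
    rw [hb, ha, hAξ₃]; field_simp
  have hκξ₃ : κe * ξ₃ = κm * (A - ξ₃) := by
    rw [hAξ₃, hξ₃]; field_simp
  have hcurl : μM * Lc ^ 2 * ξ₁ * a = 2 * μe * (2 * ξ₁ + 1 - B) + 2 * μm * (2 * ξ₁ + 1) := by
    have h : 2 * ξ₁ + 1 - B = 2 * ξ₁ - ξ₂ := by rw [hBξ₂]; ring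
    rw [h, mul_right_comm, haL, hξ₁, hξ₂]; field_simp; ring
  have hK : B + 2 * ξ₁ - ξ₂ = 2 * ξ₁ + 1 := by rw [hBξ₂]; ring
  set k := Real.sqrt a with hk
  have hk0 : k ≠ 0 := hs0.ne'
  have hdu : ∀ r : ℝ, 0 < r → deriv u r =
      C₁ * A / 2 + D₁ * B * (I0 (k * r) - I1 (k * r) / (k * r)) := by
    intro r hr
    rw [funext hu]
    refine HasDerivAt.deriv ?_
    refine ((((hasDerivAt_id' r).const_mul (C₁ * A)).div_const 2).fun_add
      ((hasDerivAt_I1_mul hk0 hr.ne').const_mul (D₁ * B / k))).congr_deriv ?_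
    field_simp
  have hdP : ∀ r : ℝ, 0 < r → HasDerivAt Pθθ (-(D₁ * ξ₁ * (k * I1 (k * r))) +
      D₁ * (2 * ξ₁ + 1) * (I0 (k * r) - 2 * I1 (k * r) / (k * r)) / r) r := by
    intro r hr
    rw [funext hPθθ]
    refine ((((hasDerivAt_I0_mul k r).const_mul (D₁ * ξ₁)).const_sub
      (C₁ / 2 * (A - ξ₃))).fun_add
        ((((hasDerivAt_I1_mul hk0 hr.ne').const_mul D₁).fun_div
          ((hasDerivAt_id' r).const_mul k) (mul_ne_zero hk0 hr.ne')).mul_const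
            (B + 2 * ξ₁ - ξ₂))).congr_deriv ?_
    rw [hK]
    field_simp
    ring
  have hW : ∀ r : ℝ, 0 < r →
      deriv Pθθ r + (Pθθ r - Prr r) / r = -(D₁ * ξ₁ * k) * I1 (k * r) := by
    intro r hr
    rw [(hdP r hr).deriv, hPrr, hZ, hPθθ, hba, hK]
    field_simp
    ring
  have hdW : ∀ r : ℝ, 0 < r → deriv (fun s => deriv Pθθ s + (Pθθ s - Prr s) / s) r =
      -(D₁ * ξ₁ * a) * (I0 (k * r) - I1 (k * r) / (k * r)) := by
    intro r hr
    have he : (fun s => deriv Pθθ s + (Pθθ s - Prr s) / s) =ᶠ[nhds r]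
        fun s => -(D₁ * ξ₁ * k) * I1 (k * s) :=
      (lt_mem_nhds hr).mono hW
    rw [he.deriv_eq, ((hasDerivAt_I1_mul hk0 hr.ne').const_mul _).deriv, ← hsa]
    field_simp
  have hdiv : ∀ r : ℝ, 0 < r → deriv (fun s => deriv u s - Prr s) r +
      deriv (fun s => u s / s - Pθθ s) r = D₁ * (B - 1) * (k * I1 (k * r)) := by
    intro r hr
    have h0 := hasDerivAt_I0_mul k r
    have h1 := hasDerivAt_I1_mul hk0 hr.ne'
    have hq : HasDerivAt (fun s => I1 (k * s) / (k * s)) _ r :=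
      h1.div ((hasDerivAt_id r).const_mul k) (mul_ne_zero hk0 hr.ne')
    have hPr : DifferentiableAt ℝ Prr r := by
      rw [funext hPrr, funext hZ]
      exact (((h0.const_mul D₁).const_add (b / a)).differentiableAt).sub
        (hdP r hr).differentiableAt
    have heq : (fun s => deriv u s - Prr s) =ᶠ[nhds r]
        fun s => C₁ * A / 2 + D₁ * B * (I0 (k * s) - I1 (k * s) / (k * s)) - Prr s :=
      (lt_mem_nhds hr).mono fun s hs => by simp only [hdu s hs]
    have hd1 : DifferentiableAt ℝ (fun s => deriv u s - Prr s) r :=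
      heq.differentiableAt_iff.mpr
        ((((h0.sub hq).const_mul (D₁ * B)).const_add (C₁ * A / 2)).differentiableAt.sub hPr)
    have hd2 : DifferentiableAt ℝ (fun s => u s / s - Pθθ s) r := by
      have hud : DifferentiableAt ℝ u r := by
        rw [funext hu]
        exact ((((hasDerivAt_id r).const_mul (C₁ * A)).div_const 2).add
          (h1.const_mul (D₁ * B / k))).differentiableAt
      exact (hud.div differentiableAt_id hr.ne').sub (hdP r hr).differentiableAt
    rw [← deriv_fun_add hd1 hd2]
    have hes : (fun s => deriv u s - Prr s + (u s / s - Pθθ s)) =ᶠ[nhds r]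
        fun s => C₁ * ξ₃ + D₁ * (B - 1) * I0 (k * s) :=
      (lt_mem_nhds hr).mono fun s (hs : 0 < s) => by
        simp only [hdu s hs, hPrr, hZ, hu, hba]
        field_simp
        ring
    rw [hes.deriv_eq, ((h0.const_mul (D₁ * (B - 1))).const_add _).deriv]
  refine ⟨fun r hr => ⟨?_, ?_, ?_⟩, ?_, ?_⟩
  · rw [hW r hr.1, hle]
    linear_combination (κe + μe) * hdiv r hr.1 + D₁ * k * I1 (k * r) * hBξ₁
  · have hr0 : r ≠ 0 := hr.1.ne'
    rw [hW r hr.1, hdu r hr.1, hPrr, hZ, hu, hPθθ, hba, hK, hle, hlm]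
    have hy : I1 (k * r) = I1 (k * r) / (k * r) * (k * r) := by field_simp
    have hur : (C₁ * A * r / 2 + D₁ * B / k * I1 (k * r)) / r =
        C₁ * A / 2 + D₁ * B * (I1 (k * r) / (k * r)) := by field_simp
    have hWr : μM * Lc ^ 2 / r * (-(D₁ * ξ₁ * k) * I1 (k * r)) =
        -(μM * Lc ^ 2 * ξ₁ * a) * D₁ * (I1 (k * r) / (k * r)) := by
      rw [← hsa]; field_simp
    rw [hur, hWr, hcurl, mul_div_assoc D₁]
    linear_combination C₁ * hκξ₃ + D₁ * I0 (k * r) * (hBξ₁ - hξ₁m)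
  · have hr0 : r ≠ 0 := hr.1.ne'
    rw [hdW r hr.1, hdu r hr.1, hPrr, hZ, hu, hPθθ, hba, hK, hle, hlm]
    have hur : (C₁ * A * r / 2 + D₁ * B / k * I1 (k * r)) / r =
        C₁ * A / 2 + D₁ * B * (I1 (k * r) / (k * r)) := by field_simp
    have hWr : μM * Lc ^ 2 * (-(D₁ * ξ₁ * a) * (I0 (k * r) - I1 (k * r) / (k * r))) =
        -(μM * Lc ^ 2 * ξ₁ * a) * D₁ * (I0 (k * r) - I1 (k * r) / (k * r)) := by
      ring
    rw [hur, hWr, hcurl, mul_div_assoc D₁]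
    linear_combination C₁ * hκξ₃ + D₁ * I0 (k * r) * (hBξ₁ - hξ₁m)
  · rw [hu, hC₁, hD₁]
    field_simp
    rw [hΔ]
    ring_nf
  · rw [hPθθ, hC₁, hD₁]
    field_simp
    rw [hΔ]
    ring_nf
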